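/- arXiv:1910.12793 — 2 statements merged into one kernel-verified Lean document; each statement's English description precedes it below -/
import Mathlib

section
/- Let K be a simplicial complex and a a vertex such that the link (K:a) is contained in a cone that is itself contained in the face-deletion (K,a). Then K is homotopy equivalent to the wedge of (K,a) with the suspension Σ(K:a). -/
open Finset

/-- An abstract simplicial complex: a collection of finite sets closed under subsets. -/
def IsSimplicialComplex {α : Type*} (K : Set (Finset α)) : Prop :=
  ∀ σ ∈ K, ∀ τ, τ ⊆ σ → τ ∈ K

/-- The link `(K : a)` of the vertex `a` in `K`. -/
def linkC {α : Type*} [DecidableEq α] (K : Set (Finset α)) (a : α) : Set (Finset α) :=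
  {τ | τ ∈ K ∧ a ∉ τ ∧ insert a τ ∈ K}

/-- The face-deletion `(K, a)` of the vertex `a` in `K`. -/
def delC {α : Type*} [DecidableEq α] (K : Set (Finset α)) (a : α) : Set (Finset α) :=
  {τ | τ ∈ K ∧ a ∉ τ}

/-- The cone `C_a(L)` with apex `a`: faces are `τ ∪ s` with `τ ∈ L` and `s ⊆ {a}`. -/
def coneC {α : Type*} [DecidableEq α] (a : α) (L : Set (Finset α)) : Set (Finset α) :=
  {σ | ∃ τ ∈ L, ∃ s ⊆ ({a} : Finset α), σ = τ ∪ s}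

/-- The suspension `Σ K = K ∗ {∅, {x}, {y}}` with two new suspension vertices
`Sum.inr 0` and `Sum.inr 1`. -/
def suspC {α : Type*} [DecidableEq α] (K : Set (Finset α)) : Set (Finset (α ⊕ Fin 2)) :=
  {σ | ∃ τ ∈ K, ∃ s ∈ ({∅, {Sum.inr 0}, {Sum.inr 1}} : Set (Finset (α ⊕ Fin 2))),
    σ = τ.image Sum.inl ∪ s}

/-- Geometric realization of a complex on a finite vertex type, as the subspace of `α → ℝ`
of convex-coefficient vectors whose support is contained in a face. -/
def realization {α : Type*} [Fintype α] (K : Set (Finset α)) : Set (α → ℝ) :=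
  {x | (∀ a, 0 ≤ x a) ∧ (∑ a, x a) = 1 ∧ ∃ σ ∈ K, ∀ a, x a ≠ 0 → a ∈ σ}

/-- The wedge (one point union) of two pointed spaces. -/
def wedgeTwo (X Y : Type*) [TopologicalSpace X] [TopologicalSpace Y] (x₀ : X) (y₀ : Y) :
    Type _ :=
  Quot (fun a b : X ⊕ Y =>
    (a = Sum.inl x₀ ∨ a = Sum.inr y₀) ∧ (b = Sum.inl x₀ ∨ b = Sum.inr y₀))

instance (X Y : Type*) [TopologicalSpace X] [TopologicalSpace Y] (x₀ : X) (y₀ : Y) :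
    TopologicalSpace (wedgeTwo X Y x₀ y₀) := by
  unfold wedgeTwo; infer_instance

section StraightLine

/-- Two maps into a subset of a real topological vector space are homotopic as soon as all the
segments joining corresponding values stay in the subset. -/
theorem homotopic_of_segment_subset {X E : Type*} [TopologicalSpace X] [AddCommGroup E]
    [Module ℝ E] [TopologicalSpace E] [IsTopologicalAddGroup E] [ContinuousSMul ℝ E] {S : Set E}
    (F G : C(X, S)) (h : ∀ x, segment ℝ (F x : E) (G x) ⊆ S) : F.Homotopic G :=
  ⟨{  toFun := fun p => ⟨AffineMap.lineMap (k := ℝ) (F p.2 : E) (G p.2 : E) (p.1 : ℝ),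
        h p.2 (by
          rw [segment_eq_image_lineMap]
          exact Set.mem_image_of_mem _ p.1.2)⟩
      continuous_toFun := by
        refine Continuous.subtype_mk ?_ _
        simp only [AffineMap.lineMap_apply_module]
        fun_prop
      map_zero_left := fun x => by ext; simp
      map_one_left := fun x => by ext; simp }⟩

end StraightLine

section Wedge

/-- The wedge of two subspaces `A` and `B`, realized as the union of the two axes in `A × B`. -/
def wedgeAxes {E F : Type*} (A : Set E) (B : Set F) (x₀ : E) (y₀ : F) : Set (E × F) :=
  {p | p.1 ∈ A ∧ p.2 ∈ B ∧ (p.1 = x₀ ∨ p.2 = y₀)}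

open Classical in
/-- The one point union of two subspaces is homeomorphic to the union of the axes in their
product. -/
theorem nonempty_homeomorph_wedgeTwo {E F : Type*} [TopologicalSpace E] [TopologicalSpace F]
    [T1Space E] [T1Space F] {A : Set E} {B : Set F} {x₀ : E} {y₀ : F} (hx : x₀ ∈ A)
    (hy : y₀ ∈ B) :
    Nonempty (wedgeAxes A B x₀ y₀ ≃ₜ wedgeTwo A B ⟨x₀, hx⟩ ⟨y₀, hy⟩) := by
  let r : A ⊕ B → A ⊕ B → Prop := fun a b =>
    (a = Sum.inl ⟨x₀, hx⟩ ∨ a = Sum.inr ⟨y₀, hy⟩) ∧ (b = Sum.inl ⟨x₀, hx⟩ ∨ b = Sum.inr ⟨y₀, hy⟩)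
  let φl : wedgeAxes A B x₀ y₀ → Quot r := fun p => Quot.mk r (Sum.inl ⟨p.1.1, p.2.1⟩)
  let φr : wedgeAxes A B x₀ y₀ → Quot r := fun p => Quot.mk r (Sum.inr ⟨p.1.2, p.2.2.1⟩)
  have hφl : Continuous φl := continuous_quot_mk.comp (by fun_prop)
  have hφr : Continuous φr := continuous_quot_mk.comp (by fun_prop)
  let φ : wedgeAxes A B x₀ y₀ → Quot r := fun p => if p.1.2 = y₀ then φl p else φr p
  have hbase : Quot.mk r (Sum.inl ⟨x₀, hx⟩) = Quot.mk r (Sum.inr ⟨y₀, hy⟩) :=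
    Quot.sound ⟨Or.inl rfl, Or.inr rfl⟩
  have hr : ∀ p : wedgeAxes A B x₀ y₀, p.1.1 = x₀ → φ p = φr p := by
    rintro ⟨⟨x, y⟩, hxA, hyB, h⟩ hp
    simp only [φ, φl, φr]
    split_ifs with hy'
    · dsimp only at hp hy'
      subst hp hy'
      exact hbase
    · rfl
  have hφ : Continuous φ := by
    have h1 : IsClosed {p : wedgeAxes A B x₀ y₀ | p.1.2 = y₀} :=
      isClosed_singleton.preimage (continuous_snd.comp continuous_subtype_val)
    have h2 : IsClosed {p : wedgeAxes A B x₀ y₀ | p.1.1 = x₀} :=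
      isClosed_singleton.preimage (continuous_fst.comp continuous_subtype_val)
    have hc := ContinuousOn.union_of_isClosed (f := φ)
      (hφl.continuousOn.congr fun p hp => if_pos hp)
      (hφr.continuousOn.congr fun p hp => hr p hp) h1 h2
    rw [← continuousOn_univ]
    exact hc.mono fun p _ => p.2.2.2.symm
  let ψ₀ : A ⊕ B → wedgeAxes A B x₀ y₀ :=
    Sum.elim (fun x => ⟨(x, y₀), x.2, hy, Or.inr rfl⟩) (fun y => ⟨(x₀, y), hx, y.2, Or.inl rfl⟩)
  have hψ₀ : Continuous ψ₀ := by
    refine Continuous.sumElim ?_ ?_ <;> fun_prop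
  have hbase₀ : ∀ u, (u = Sum.inl ⟨x₀, hx⟩ ∨ u = Sum.inr ⟨y₀, hy⟩) →
      ψ₀ u = ⟨(x₀, y₀), hx, hy, Or.inl rfl⟩ := by
    rintro u (rfl | rfl) <;> rfl
  let ψ : Quot r → wedgeAxes A B x₀ y₀ :=
    Quot.lift ψ₀ fun u v h => (hbase₀ u h.1).trans (hbase₀ v h.2).symm
  refine ⟨{ toFun := φ, invFun := ψ, left_inv := ?_, right_inv := ?_, continuous_toFun := hφ,
            continuous_invFun := continuous_quot_lift _ hψ₀ }⟩
  · rintro ⟨⟨x, y⟩, hxA, hyB, h⟩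
    by_cases hy' : y = y₀
    · subst hy'
      simp [φ, ψ, φl, ψ₀]
    · have hx' : x = x₀ := h.resolve_right hy'
      subst hx'
      simp [φ, ψ, φr, ψ₀, hy']
  · rintro ⟨x | y⟩
    · exact if_pos rfl
    · exact hr _ rfl

end Wedge

section Realization

theorem segment_subset_realization {α : Type*} [Fintype α] {K : Set (Finset α)} {x y : α → ℝ}
    (hx : x ∈ realization K) (hy : y ∈ realization K) {σ : Finset α} (hσ : σ ∈ K)
    (hxσ : ∀ v, x v ≠ 0 → v ∈ σ) (hyσ : ∀ v, y v ≠ 0 → v ∈ σ) :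
    segment ℝ x y ⊆ realization K := by
  rintro _ ⟨s, t, hs, ht, hst, rfl⟩
  refine ⟨fun v => ?_, ?_, σ, hσ, fun v hv => ?_⟩
  · have h1 := hx.1 v
    have h2 := hy.1 v
    simp only [Pi.add_apply, Pi.smul_apply, smul_eq_mul]
    positivity
  · simp [Finset.sum_add_distrib, ← Finset.mul_sum, hx.2.1, hy.2.1, hst]
  · by_contra hvσ
    have h1 : x v = 0 := by_contra fun h => hvσ (hxσ v h)
    have h2 : y v = 0 := by_contra fun h => hvσ (hyσ v h)
    simp [h1, h2] at hv

theorem realization_mono {α : Type*} [Fintype α] {K K' : Set (Finset α)} (h : K ⊆ K') : realization K ⊆ realization K' :=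
  fun _ hx => ⟨hx.1, hx.2.1, hx.2.2.imp fun _ hσ => ⟨h hσ.1, hσ.2⟩⟩

theorem apply_le_one_of_mem_realization {α : Type*} [Fintype α] {K : Set (Finset α)} {x : α → ℝ}
    (hx : x ∈ realization K) (v : α) : x v ≤ 1 :=
  hx.2.1 ▸ Finset.single_le_sum (fun w _ => hx.1 w) (Finset.mem_univ v)

theorem single_mem_realization {α : Type*} [Fintype α] [DecidableEq α] {K : Set (Finset α)}
    {v : α} (hv : {v} ∈ K) : Pi.single v (1 : ℝ) ∈ realization K := by
  refine ⟨fun w => ?_, by simp, {v}, hv, fun w hw => ?_⟩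
  · rw [Pi.single_apply]
    split_ifs <;> norm_num
  · by_contra h
    simp_all [Pi.single_apply]

theorem exists_face_suspC {α : Type*} [DecidableEq α] {L : Set (Finset α)}
    {y : α ⊕ Fin 2 → ℝ} :
    (∃ σ ∈ suspC L, ∀ v, y v ≠ 0 → v ∈ σ) ↔
      ∃ τ ∈ L, (∀ v, y (Sum.inl v) ≠ 0 → v ∈ τ) ∧ (y (Sum.inr 0) = 0 ∨ y (Sum.inr 1) = 0) := by
  constructor
  · rintro ⟨_, ⟨τ, hτ, s, hs, rfl⟩, h⟩
    refine ⟨τ, hτ, fun v hv => ?_, ?_⟩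
    · have := h _ hv
      rcases hs with rfl | rfl | rfl <;> simpa using this
    · by_contra! hne
      have h0 := h _ hne.1
      have h1 := h _ hne.2
      rcases hs with rfl | rfl | rfl <;> simp at h0 h1
  · rintro ⟨τ, hτ, h, h0 | h1⟩
    · refine ⟨_, ⟨τ, hτ, {Sum.inr 1}, by simp, rfl⟩, ?_⟩
      rintro (v | i) hv
      · simpa using h v hv
      · fin_cases i <;> simp_all
    · refine ⟨_, ⟨τ, hτ, {Sum.inr 0}, by simp, rfl⟩, ?_⟩
      rintro (v | i) hv
      · simpa using h v hv
      · fin_cases i <;> simp_all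

theorem segment_subset_realization_suspC {α : Type*} [Fintype α] [DecidableEq α]
    {L : Set (Finset α)} {x y : α ⊕ Fin 2 → ℝ}
    (hx : x ∈ realization (suspC L)) (hy : y ∈ realization (suspC L)) {τ : Finset α} (hτ : τ ∈ L)
    (hxτ : ∀ v, x (Sum.inl v) ≠ 0 → v ∈ τ) (hyτ : ∀ v, y (Sum.inl v) ≠ 0 → v ∈ τ)
    (h : (x (Sum.inr 0) = 0 ∧ y (Sum.inr 0) = 0) ∨ (x (Sum.inr 1) = 0 ∧ y (Sum.inr 1) = 0)) :
    segment ℝ x y ⊆ realization (suspC L) := by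
  have hx0 := hx.1
  have hy0 := hy.1
  obtain ⟨σ, hσ, hs⟩ := (exists_face_suspC (L := L) (y := fun v => |x v| + |y v|)).2
    ⟨τ, hτ, fun v hv => by
      by_contra hvτ
      have h1 : x (Sum.inl v) = 0 := by_contra fun h => hvτ (hxτ v h)
      have h2 : y (Sum.inl v) = 0 := by_contra fun h => hvτ (hyτ v h)
      simp [h1, h2] at hv, by
      rcases h with h | h <;> simp [h.1, h.2]⟩
  refine segment_subset_realization hx hy hσ (fun v hv => hs v ?_) (fun v hv => hs v ?_)
  · have := abs_pos.2 hv
    positivity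
  · have := abs_pos.2 hv
    positivity

end Realization

section Parameters

/-- The piecewise linear function equal to `1 - 2t` for `t ≤ 1/2` and to `0` afterwards. -/
noncomputable def fade (t : ℝ) : ℝ := max 0 (1 - 2 * t)

/-- The piecewise linear function that vanishes for `t ≤ 1/2`, equals `4` for `t ≥ 3/4`, and is
affine in between. -/
noncomputable def rise (t : ℝ) : ℝ := max 0 (min (16 * t - 8) 4)

/-- The piecewise linear function that vanishes for `t ≤ 3/4` and takes the value `1` at `1`. -/
noncomputable def excess (t : ℝ) : ℝ := max 0 (4 * t - 3)

/-- The factor `(1 - excess t) / (1 - t)`, extended continuously to `t = 1`. -/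
noncomputable def scaling (t : ℝ) : ℝ := (max (1 - t) (1 / 4))⁻¹

@[fun_prop]
theorem continuous_fade : Continuous fade := by unfold fade; fun_prop

@[fun_prop]
theorem continuous_rise : Continuous rise := by unfold rise; fun_prop

@[fun_prop]
theorem continuous_excess : Continuous excess := by unfold excess; fun_prop

@[fun_prop]
theorem continuous_scaling : Continuous scaling := by
  unfold scaling
  exact Continuous.inv₀ (by fun_prop) fun t =>
    ((by norm_num : (0 : ℝ) < 1 / 4).trans_le (le_max_right _ _)).ne'

theorem fade_nonneg (t : ℝ) : 0 ≤ fade t := le_max_left _ _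

theorem rise_nonneg (t : ℝ) : 0 ≤ rise t := le_max_left _ _

theorem excess_nonneg (t : ℝ) : 0 ≤ excess t := le_max_left _ _

theorem scaling_nonneg (t : ℝ) : 0 ≤ scaling t :=
  inv_nonneg.2 ((by norm_num : (0 : ℝ) ≤ 1 / 4).trans (le_max_right _ _))

theorem fade_zero : fade 0 = 1 := by norm_num [fade]

theorem fade_of_half_le {t : ℝ} (h : 1 / 2 ≤ t) : fade t = 0 := max_eq_left (by linarith)

theorem fade_of_le_half {t : ℝ} (h : t ≤ 1 / 2) : fade t = 1 - 2 * t :=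
  max_eq_right (by linarith)

theorem rise_of_le_half {t : ℝ} (h : t ≤ 1 / 2) : rise t = 0 :=
  max_eq_left ((min_le_left _ _).trans (by linarith))

theorem rise_of_mem_Icc {t : ℝ} (h₁ : 1 / 2 ≤ t) (h₂ : t ≤ 3 / 4) : rise t = 16 * t - 8 := by
  rw [rise, min_eq_left (by linarith), max_eq_right (by linarith)]

theorem rise_of_le {t : ℝ} (h : 3 / 4 ≤ t) : rise t = 4 := by
  rw [rise, min_eq_right (by linarith), max_eq_right (by norm_num)]

theorem excess_of_le {t : ℝ} (h : t ≤ 3 / 4) : excess t = 0 := max_eq_left (by linarith)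

theorem excess_zero : excess 0 = 0 := excess_of_le (by norm_num)

theorem excess_of_ge {t : ℝ} (h : 3 / 4 ≤ t) : excess t = 4 * t - 3 := max_eq_right (by linarith)

theorem scaling_zero : scaling 0 = 1 := by
  rw [scaling, max_eq_left (by norm_num)]; norm_num

theorem scaling_of_ge {t : ℝ} (h : 3 / 4 ≤ t) : scaling t = 4 := by
  rw [scaling, max_eq_right (by linarith)]; norm_num

theorem scaling_mul_add_excess (t : ℝ) : scaling t * (1 - t) + excess t = 1 := by
  rcases le_total t (3 / 4) with h | h
  · rw [scaling, max_eq_left (by linarith), excess_of_le h, inv_mul_cancel₀ (by linarith), add_zero]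
  · rw [scaling_of_ge h, excess_of_ge h]
    ring

theorem fade_mul_le_one {t : ℝ} (h₀ : 0 ≤ t) (h₁ : t ≤ 1) : fade t * (1 - t) ≤ 1 := by
  rcases le_total t (1 / 2) with h | h
  · rw [fade_of_le_half h]; nlinarith
  · rw [fade_of_half_le h]; norm_num

/-- The weight left over once the link part and the apex have received theirs. -/
noncomputable def deficit (t : ℝ) : ℝ := 1 - excess t - rise t * (1 - t)

@[fun_prop]
theorem continuous_deficit : Continuous deficit := by unfold deficit; fun_prop

theorem deficit_of_le_half {t : ℝ} (h : t ≤ 1 / 2) : deficit t = 1 := by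
  rw [deficit, rise_of_le_half h, excess_of_le (by linarith)]; ring

theorem deficit_of_ge {t : ℝ} (h : 3 / 4 ≤ t) : deficit t = 0 := by
  rw [deficit, rise_of_le h, excess_of_ge h]; ring

theorem deficit_nonneg (t : ℝ) : 0 ≤ deficit t := by
  rcases le_total t (1 / 2) with h | h
  · rw [deficit_of_le_half h]; norm_num
  rcases le_total t (3 / 4) with h' | h'
  · rw [deficit, rise_of_mem_Icc h h', excess_of_le h']
    nlinarith [sq_nonneg (4 * t - 3)]
  · rw [deficit_of_ge h']

end Parameters

section Maps

variable {α : Type*} [DecidableEq α]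

/-- The vector `x` with its coordinate at `a` erased. -/
def offApex (a : α) (x : α → ℝ) (v : α) : ℝ := if v = a then 0 else x v

@[simp]
theorem offApex_self (a : α) (x : α → ℝ) : offApex a x a = 0 := if_pos rfl

theorem offApex_of_ne {a v : α} (h : v ≠ a) (x : α → ℝ) : offApex a x v = x v := if_neg h

@[fun_prop]
theorem continuous_offApex (a v : α) : Continuous fun x : α → ℝ => offApex a x v := by
  unfold offApex
  split_ifs <;> fun_prop

theorem offApex_nonneg {a : α} {x : α → ℝ} (hx : ∀ v, 0 ≤ x v) (v : α) : 0 ≤ offApex a x v := by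
  unfold offApex
  split_ifs
  exacts [le_rfl, hx v]

theorem offApex_ne_zero {a : α} {x : α → ℝ} {v : α} (h : offApex a x v ≠ 0) : v ≠ a ∧ x v ≠ 0 := by
  by_cases hv : v = a
  · subst hv; simp at h
  · exact ⟨hv, by rwa [offApex_of_ne hv] at h⟩

theorem sum_offApex [Fintype α] {a : α} {x : α → ℝ} (hx : ∑ v, x v = 1) :
    ∑ v, offApex a x v = 1 - x a := by
  have h : ∀ v, offApex a x v = x v - (Pi.single a (x a) : α → ℝ) v := fun v => by
    by_cases hv : v = a
    · subst hv; simp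
    · simp [offApex_of_ne hv, hv]
  simp [h, Finset.sum_sub_distrib, hx]

/-- Rescaling of the cone coordinate at `a`, vanishing for values up to `3/4`. -/
noncomputable def squeeze (a : α) (x : α → ℝ) : α → ℝ := fun v =>
  scaling (x a) * offApex a x v + excess (x a) * (Pi.single a 1 : α → ℝ) v

/-- The map to the deletion of `a` that contracts the cone with apex `a` to the vertex `b`. -/
noncomputable def contractTo (a b : α) (x : α → ℝ) : α → ℝ := fun v =>
  fade (x a) * offApex a x v + (1 - fade (x a) * (1 - x a)) * (Pi.single b 1 : α → ℝ) v

/-- The map to the suspension of the link of `a` that collapses the deletion of `a`. -/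
noncomputable def collapse (a : α) (x : α → ℝ) : α ⊕ Fin 2 → ℝ :=
  Sum.elim (fun v => rise (x a) * offApex a x v) ![deficit (x a), excess (x a)]

/-- The map folding the wedge of the deletion and the suspension onto the complex: it sends the
suspension vertices to `b` and `a`. -/
noncomputable def wedgeFold (a b : α) (p : (α → ℝ) × (α ⊕ Fin 2 → ℝ)) : α → ℝ := fun v =>
  p.1 v + p.2 (Sum.inl v) + (p.2 (Sum.inr 0) - 1) * (Pi.single b 1 : α → ℝ) v
    + p.2 (Sum.inr 1) * (Pi.single a 1 : α → ℝ) v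

theorem continuous_squeeze (a : α) : Continuous (squeeze a) := by unfold squeeze; fun_prop

theorem continuous_contractTo (a b : α) : Continuous (contractTo a b) := by
  unfold contractTo; fun_prop

theorem continuous_collapse (a : α) : Continuous (collapse a) := by
  refine continuous_pi ?_
  rintro (v | i)
  · simp only [collapse, Sum.elim_inl]; fun_prop
  · fin_cases i <;> simp [collapse] <;> fun_prop

theorem continuous_wedgeFold (a b : α) : Continuous (wedgeFold a b) := by unfold wedgeFold; fun_prop

@[simp]
theorem collapse_inl (a : α) (x : α → ℝ) (v : α) :
    collapse a x (Sum.inl v) = rise (x a) * offApex a x v := rfl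

@[simp]
theorem collapse_inr_zero (a : α) (x : α → ℝ) : collapse a x (Sum.inr 0) = deficit (x a) := rfl

@[simp]
theorem collapse_inr_one (a : α) (x : α → ℝ) : collapse a x (Sum.inr 1) = excess (x a) := rfl

theorem squeeze_self (a : α) (x : α → ℝ) : squeeze a x a = excess (x a) := by simp [squeeze]

theorem squeeze_of_ne {a v : α} (h : v ≠ a) (x : α → ℝ) :
    squeeze a x v = scaling (x a) * x v := by simp [squeeze, offApex_of_ne h, h]

theorem squeeze_of_eq_zero {a : α} {x : α → ℝ} (h : x a = 0) : squeeze a x = x := by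
  funext v
  by_cases hv : v = a
  · subst hv; simp [squeeze_self, h, excess_zero]
  · simp [squeeze_of_ne hv, h, scaling_zero]

theorem ne_zero_of_squeeze_ne_zero {a v : α} {x : α → ℝ} (h : squeeze a x v ≠ 0) : x v ≠ 0 := by
  intro h0
  by_cases hv : v = a
  · subst hv
    exact h (by rw [squeeze_self, h0, excess_zero])
  · exact h (by rw [squeeze_of_ne hv, h0, mul_zero])

theorem contractTo_of_eq_zero {a b : α} {x : α → ℝ} (h : x a = 0) : contractTo a b x = x := by
  funext v
  by_cases hv : v = a
  · subst hv; simp [contractTo, h, fade_zero]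
  · simp [contractTo, h, fade_zero, offApex_of_ne hv]

theorem contractTo_of_half_le {a b : α} {x : α → ℝ} (h : 1 / 2 ≤ x a) :
    contractTo a b x = Pi.single b 1 := by
  funext v
  simp [contractTo, fade_of_half_le h]

theorem collapse_of_le_half {a : α} {x : α → ℝ} (h : x a ≤ 1 / 2) :
    collapse a x = Pi.single (Sum.inr 0) 1 := by
  funext v
  rcases v with v | i
  · simp [rise_of_le_half h]
  · fin_cases i
    · simp [deficit_of_le_half h]
    · simp [excess_of_le (h.trans (by norm_num))]

theorem wedgeFold_single_right (a b : α) (x : α → ℝ) :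
    wedgeFold a b (x, Pi.single (Sum.inr 0) 1) = x := by
  funext v
  simp [wedgeFold]

theorem wedgeFold_single_left (a b : α) (y : α ⊕ Fin 2 → ℝ) (v : α) :
    wedgeFold a b (Pi.single b 1, y) v =
      y (Sum.inl v) + y (Sum.inr 0) * (Pi.single b 1 : α → ℝ) v
        + y (Sum.inr 1) * (Pi.single a 1 : α → ℝ) v := by
  simp only [wedgeFold]
  ring

variable [Fintype α]

theorem squeeze_mem_realization {K : Set (Finset α)} (a : α) {x : α → ℝ}
    (hx : x ∈ realization K) : squeeze a x ∈ realization K := by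
  obtain ⟨h0, h1, σ, hσ, hs⟩ := hx
  refine ⟨fun v => ?_, ?_, σ, hσ, fun v hv => hs v (ne_zero_of_squeeze_ne_zero hv)⟩
  · by_cases hv : v = a
    · subst hv; rw [squeeze_self]; exact excess_nonneg _
    · rw [squeeze_of_ne hv]; exact mul_nonneg (scaling_nonneg _) (h0 v)
  · simp [squeeze, Finset.sum_add_distrib, ← Finset.mul_sum, sum_offApex h1,
      scaling_mul_add_excess]

theorem segment_squeeze_subset {K : Set (Finset α)} (a : α) {x : α → ℝ}
    (hx : x ∈ realization K) : segment ℝ x (squeeze a x) ⊆ realization K := by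
  obtain ⟨σ, hσ, hs⟩ := hx.2.2
  exact segment_subset_realization hx (squeeze_mem_realization a hx) hσ hs
    fun v hv => hs v (ne_zero_of_squeeze_ne_zero hv)

end Maps

section Complex

variable {α : Type*} [DecidableEq α] {K : Set (Finset α)} {a b : α}

theorem insert_mem_delC_of_link_subset_cone (hK : IsSimplicialComplex K) {L : Set (Finset α)}
    (h₁ : linkC K a ⊆ coneC b L) (h₂ : coneC b L ⊆ delC K a) {τ : Finset α}
    (hτ : τ ∈ linkC K a) : insert b τ ∈ delC K a := by
  obtain ⟨ρ, hρ, s, hs, rfl⟩ := h₁ hτ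
  have h := h₂ ⟨ρ, hρ, {b}, subset_rfl, rfl⟩
  have hsub : insert b (ρ ∪ s) ⊆ ρ ∪ {b} := by
    intro v hv
    simp only [Finset.mem_insert, Finset.mem_union] at hv ⊢
    rcases hv with rfl | hv | hv
    · simp
    · exact Or.inl hv
    · exact Or.inr (hs hv)
  exact ⟨hK _ h.1 _ hsub, fun ha => h.2 (hsub ha)⟩

theorem mem_insert_of_contractTo_ne_zero {σ : Finset α} {x : α → ℝ}
    (hs : ∀ v, v ≠ a → x v ≠ 0 → v ∈ σ) {v : α} (hv : contractTo a b x v ≠ 0) :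
    v ∈ insert b σ := by
  by_contra hvσ
  rw [Finset.mem_insert, not_or] at hvσ
  have h : offApex a x v = 0 := by_contra fun h =>
    hvσ.2 (hs v (offApex_ne_zero h).1 (offApex_ne_zero h).2)
  simp [contractTo, h, hvσ.1] at hv

variable [Fintype α]

theorem exists_face_erase (hK : IsSimplicialComplex K) {x : α → ℝ} (hx : x ∈ realization K) :
    ∃ σ ∈ delC K a, (∀ v, v ≠ a → x v ≠ 0 → v ∈ σ) ∧ (x a ≠ 0 → σ ∈ linkC K a) := by
  obtain ⟨-, -, σ, hσ, hs⟩ := hx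
  have he : σ.erase a ∈ K := hK σ hσ _ (Finset.erase_subset _ _)
  refine ⟨σ.erase a, ⟨he, Finset.notMem_erase _ _⟩,
    fun v hv h => Finset.mem_erase.2 ⟨hv, hs v h⟩, fun h => ⟨he, Finset.notMem_erase _ _, ?_⟩⟩
  rwa [Finset.insert_erase (hs a h)]

theorem apply_apex_eq_zero {x : α → ℝ} (hx : x ∈ realization (delC K a)) : x a = 0 := by
  obtain ⟨-, -, σ, hσ, hs⟩ := hx
  exact by_contra fun h => hσ.2 (hs a h)

theorem contractTo_mem (hK : IsSimplicialComplex K)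
    (hab : ∀ τ ∈ linkC K a, insert b τ ∈ delC K a) {x : α → ℝ} (hx : x ∈ realization K) :
    contractTo a b x ∈ realization (delC K a) := by
  have ht0 := hx.1 a
  have ht1 := apply_le_one_of_mem_realization hx a
  obtain ⟨σ, hσ, hs, hl⟩ := exists_face_erase (a := a) hK hx
  refine ⟨fun v => ?_, ?_, ?_⟩
  · have h1 := fade_mul_le_one ht0 ht1
    have h2 : (0 : ℝ) ≤ (Pi.single b 1 : α → ℝ) v := by
      rw [Pi.single_apply]; split_ifs <;> norm_num
    exact add_nonneg (mul_nonneg (fade_nonneg _) (offApex_nonneg hx.1 v))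
      (mul_nonneg (by linarith) h2)
  · simp [contractTo, Finset.sum_add_distrib, ← Finset.mul_sum, sum_offApex hx.2.1]
  · by_cases h : x a = 0
    · rw [contractTo_of_eq_zero h]
      exact ⟨σ, hσ, fun v hv => hs v (by rintro rfl; exact hv h) hv⟩
    · exact ⟨_, hab σ (hl h), fun v hv => mem_insert_of_contractTo_ne_zero hs hv⟩

theorem collapse_mem (hK : IsSimplicialComplex K) (ha : {a} ∈ K) {x : α → ℝ}
    (hx : x ∈ realization K) : collapse a x ∈ realization (suspC (linkC K a)) := by
  refine ⟨?_, ?_, exists_face_suspC.2 ?_⟩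
  · rintro (v | i)
    · exact mul_nonneg (rise_nonneg _) (offApex_nonneg hx.1 v)
    · fin_cases i
      exacts [deficit_nonneg _, excess_nonneg _]
  · simp [Fintype.sum_sum_type, ← Finset.mul_sum, sum_offApex hx.2.1, deficit]
    ring
  · have hz : collapse a x (Sum.inr 0) = 0 ∨ collapse a x (Sum.inr 1) = 0 := by
      rcases le_total (3 / 4) (x a) with h | h
      · exact Or.inl (deficit_of_ge h)
      · exact Or.inr (excess_of_le h)
    obtain ⟨σ, hσ, hs, hl⟩ := exists_face_erase (a := a) hK hx
    by_cases h : x a = 0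
    · refine ⟨∅, ⟨hK _ ha _ (Finset.empty_subset _), Finset.notMem_empty _, by simpa using ha⟩,
        fun v hv => ?_, hz⟩
      simp [h, rise_of_le_half] at hv
    · refine ⟨σ, hl h, fun v hv => ?_, hz⟩
      have := offApex_ne_zero (right_ne_zero_of_mul hv)
      exact hs v this.1 this.2

theorem wedgeFold_mem_of_left (hab : ∀ τ ∈ linkC K a, insert b τ ∈ delC K a)
    {y : α ⊕ Fin 2 → ℝ} (hy : y ∈ realization (suspC (linkC K a))) :
    wedgeFold a b (Pi.single b 1, y) ∈ realization K := by
  obtain ⟨τ, hτ, hs, hz⟩ := exists_face_suspC.1 hy.2.2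
  refine ⟨fun v => ?_, ?_, ?_⟩
  · rw [wedgeFold_single_left, Pi.single_apply, Pi.single_apply]
    have := hy.1 (Sum.inl v)
    have := hy.1 (Sum.inr 0)
    have := hy.1 (Sum.inr 1)
    split_ifs <;> linarith
  · have h := hy.2.1
    simp only [Fintype.sum_sum_type, Fin.sum_univ_two] at h
    simp only [wedgeFold_single_left, Finset.sum_add_distrib, ← Finset.mul_sum,
      Finset.sum_pi_single', Finset.mem_univ, if_true]
    linarith
  · rcases hz with h | h
    · refine ⟨_, hτ.2.2, fun v hv => ?_⟩
      by_contra hvτ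
      rw [Finset.mem_insert, not_or] at hvτ
      have h' : y (Sum.inl v) = 0 := by_contra fun h' => hvτ.2 (hs v h')
      simp [wedgeFold_single_left, h, h', hvτ.1] at hv
    · refine ⟨_, (hab τ hτ).1, fun v hv => ?_⟩
      by_contra hvτ
      rw [Finset.mem_insert, not_or] at hvτ
      have h' : y (Sum.inl v) = 0 := by_contra fun h' => hvτ.2 (hs v h')
      simp [wedgeFold_single_left, h, h', hvτ.1] at hv

theorem wedgeFold_single_left_apex (hba : b ≠ a) {y : α ⊕ Fin 2 → ℝ}
    (hy : y ∈ realization (suspC (linkC K a))) :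
    wedgeFold a b (Pi.single b 1, y) a = y (Sum.inr 1) := by
  obtain ⟨τ, hτ, hs, hz⟩ := exists_face_suspC.1 hy.2.2
  have h : y (Sum.inl a) = 0 := by_contra fun h => hτ.2.1 (hs a h)
  simp [wedgeFold_single_left, h, hba.symm]

theorem wedgeFold_mem (hab : ∀ τ ∈ linkC K a, insert b τ ∈ delC K a)
    {p : (α → ℝ) × (α ⊕ Fin 2 → ℝ)}
    (hp : p ∈ wedgeAxes (realization (delC K a)) (realization (suspC (linkC K a)))
      (Pi.single b 1) (Pi.single (Sum.inr 0) 1)) : wedgeFold a b p ∈ realization K := by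
  obtain ⟨x, y⟩ := p
  obtain ⟨hx, hy, h⟩ := hp
  dsimp only at hx hy h
  rcases h with rfl | rfl
  · exact wedgeFold_mem_of_left hab hy
  · rw [wedgeFold_single_right]
    exact realization_mono (fun _ h => h.1) hx

theorem contractTo_collapse_mem (hK : IsSimplicialComplex K) (ha : {a} ∈ K)
    (hab : ∀ τ ∈ linkC K a, insert b τ ∈ delC K a) {x : α → ℝ} (hx : x ∈ realization K) :
    (contractTo a b x, collapse a x) ∈
      wedgeAxes (realization (delC K a)) (realization (suspC (linkC K a)))
        (Pi.single b 1) (Pi.single (Sum.inr 0) 1) := by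
  refine ⟨contractTo_mem hK hab hx, collapse_mem hK ha hx, ?_⟩
  rcases le_total (1 / 2) (x a) with h | h
  · exact Or.inl (contractTo_of_half_le h)
  · exact Or.inr (collapse_of_le_half h)

/-- The segment joining the squeezed point to its image under the composite of the two homotopy
equivalences stays in the complex. -/
theorem segment_wedgeFold_subset (hK : IsSimplicialComplex K) (ha : {a} ∈ K)
    (hab : ∀ τ ∈ linkC K a, insert b τ ∈ delC K a) {x : α → ℝ} (hx : x ∈ realization K) :
    segment ℝ (squeeze a x) (wedgeFold a b (contractTo a b x, collapse a x)) ⊆ realization K := by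
  have hm1 := squeeze_mem_realization a hx
  have hm2 := wedgeFold_mem hab (contractTo_collapse_mem hK ha hab hx)
  by_cases h0 : x a = 0
  · rw [squeeze_of_eq_zero h0, contractTo_of_eq_zero h0, collapse_of_le_half (by rw [h0]; norm_num),
      wedgeFold_single_right, segment_same, Set.singleton_subset_iff]
    exact hx
  obtain ⟨σ, hσ, hs, hl⟩ := exists_face_erase (a := a) hK hx
  have hlink := hl h0
  have hoff : ∀ v, v ∉ σ → offApex a x v = 0 := fun v hv => by_contra fun h =>
    hv (hs v (offApex_ne_zero h).1 (offApex_ne_zero h).2)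
  rcases le_total (x a) (3 / 4) with ht | ht
  · have he := excess_of_le ht
    refine segment_subset_realization hm1 hm2 (hab σ hlink).1 (fun v hv => ?_) (fun v hv => ?_)
    all_goals
      by_contra hvσ
      rw [Finset.mem_insert, not_or] at hvσ
      simp [squeeze, wedgeFold, contractTo, he, hoff v hvσ.2, hvσ.1] at hv
  · have hd := deficit_of_ge ht
    have hf := fade_of_half_le (le_trans (by norm_num) ht)
    refine segment_subset_realization hm1 hm2 hlink.2.2 (fun v hv => ?_) (fun v hv => ?_)
    all_goals
      by_contra hvσ
      rw [Finset.mem_insert, not_or] at hvσ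
      simp [squeeze, wedgeFold, contractTo, hd, hf, hoff v hvσ.2, hvσ.1] at hv

/-- On the suspension, contracting the deletion part moves points within a common face. -/
theorem segment_contractTo_subset (hK : IsSimplicialComplex K)
    (hb : {b} ∈ delC K a) (hab : ∀ τ ∈ linkC K a, insert b τ ∈ delC K a) {y : α ⊕ Fin 2 → ℝ}
    (hy : y ∈ realization (suspC (linkC K a))) :
    segment ℝ (contractTo a b (wedgeFold a b (Pi.single b 1, y))) (Pi.single b 1) ⊆
      realization (delC K a) := by
  obtain ⟨τ, hτ, hs, -⟩ := exists_face_suspC.1 hy.2.2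
  refine segment_subset_realization (contractTo_mem hK hab (wedgeFold_mem_of_left hab hy))
    (single_mem_realization hb) (hab τ hτ) (fun v hv => ?_) (fun v hv => ?_)
  · have : v ∈ insert b (insert b τ) := by
      refine mem_insert_of_contractTo_ne_zero (fun w hw h => ?_) hv
      by_contra hwτ
      rw [Finset.mem_insert, not_or] at hwτ
      have h' : y (Sum.inl w) = 0 := by_contra fun h' => hwτ.2 (hs w h')
      simp [wedgeFold_single_left, h', hw, hwτ.1] at h
    simpa using this
  · by_contra hvτ
    rw [Finset.mem_insert, not_or] at hvτ
    simp [hvτ.1] at hv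

/-- On the suspension, collapsing and squeezing give points of a common face. -/
theorem segment_collapse_subset (hK : IsSimplicialComplex K) (ha : {a} ∈ K) (hba : b ≠ a)
    (hab : ∀ τ ∈ linkC K a, insert b τ ∈ delC K a) {y : α ⊕ Fin 2 → ℝ}
    (hy : y ∈ realization (suspC (linkC K a))) :
    segment ℝ (collapse a (wedgeFold a b (Pi.single b 1, y))) (squeeze (Sum.inr 1) y) ⊆
      realization (suspC (linkC K a)) := by
  obtain ⟨τ, hτ, hs, hz⟩ := exists_face_suspC.1 hy.2.2
  have hapex := wedgeFold_single_left_apex hba hy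
  refine segment_subset_realization_suspC (collapse_mem hK ha (wedgeFold_mem_of_left hab hy))
    (squeeze_mem_realization _ hy) hτ (fun v hv => ?_)
    (fun v hv => hs v (ne_zero_of_squeeze_ne_zero hv)) ?_
  · rw [collapse_inl, hapex] at hv
    have h1 : y (Sum.inr 1) ≠ 0 := fun h => by simp [h, rise_of_le_half] at hv
    have h0 := hz.resolve_right h1
    have hv' := offApex_ne_zero (right_ne_zero_of_mul hv)
    refine hs v fun h => hv'.2 ?_
    simp [wedgeFold_single_left, h0, h, hv'.1]
  · rw [collapse_inr_zero, collapse_inr_one, hapex, squeeze_self, squeeze_of_ne (by simp)]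
    rcases le_total (y (Sum.inr 1)) (3 / 4) with h | h
    · exact Or.inr ⟨excess_of_le h, excess_of_le h⟩
    · have h0 := hz.resolve_right (by linarith)
      exact Or.inl ⟨deficit_of_ge h, by rw [h0, mul_zero]⟩

end Complex

/-- if the link of `a` in `K` is contained in a cone (with apex a vertex `b` of
the face-deletion) contained in the face-deletion of `a`, then `K` is homotopy equivalent to
the wedge of `(K, a)` with the suspension `Σ(K : a)`. -/
theorem wedge_decomposition {α : Type*} [Fintype α] [DecidableEq α]
    (K : Set (Finset α)) (hK : IsSimplicialComplex K) (a : α) (ha : {a} ∈ K)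
    (b : α) (L : Set (Finset α)) (hb : {b} ∈ delC K a)
    (h₁ : linkC K a ⊆ coneC b L) (h₂ : coneC b L ⊆ delC K a) :
    ∃ (x₀ : realization (delC K a)) (y₀ : realization (suspC (linkC K a))),
      Nonempty (ContinuousMap.HomotopyEquiv (realization K)
        (wedgeTwo (realization (delC K a)) (realization (suspC (linkC K a))) x₀ y₀)) := by
  have hab : ∀ τ ∈ linkC K a, insert b τ ∈ delC K a := fun τ hτ =>
    insert_mem_delC_of_link_subset_cone hK h₁ h₂ hτ
  have hba : b ≠ a := fun h => hb.2 (by simp [h])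
  have hxA : (Pi.single b 1 : α → ℝ) ∈ realization (delC K a) := single_mem_realization hb
  have hyB : (Pi.single (Sum.inr 0) 1 : α ⊕ Fin 2 → ℝ) ∈ realization (suspC (linkC K a)) :=
    single_mem_realization ⟨∅, ⟨hK _ ha _ (Finset.empty_subset _), Finset.notMem_empty _,
      by simpa using ha⟩, {Sum.inr 0}, by simp, by simp⟩
  refine ⟨⟨_, hxA⟩, ⟨_, hyB⟩, ?_⟩
  obtain ⟨e⟩ := nonempty_homeomorph_wedgeTwo hxA hyB
  let W := wedgeAxes (realization (delC K a)) (realization (suspC (linkC K a)))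
    (Pi.single b 1) (Pi.single (Sum.inr 0) 1)
  let f : C(realization K, W) :=
    ⟨fun x => ⟨(contractTo a b x, collapse a x), contractTo_collapse_mem hK ha hab x.2⟩,
      (((continuous_contractTo a b).prodMk (continuous_collapse a)).comp
        continuous_subtype_val).subtype_mk _⟩
  let g : C(W, realization K) :=
    ⟨fun p => ⟨wedgeFold a b p, wedgeFold_mem hab p.2⟩,
      ((continuous_wedgeFold a b).comp continuous_subtype_val).subtype_mk _⟩
  let s : C(realization K, realization K) :=
    ⟨fun x => ⟨squeeze a x, squeeze_mem_realization a x.2⟩,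
      ((continuous_squeeze a).comp continuous_subtype_val).subtype_mk _⟩
  have hsq : squeeze (Sum.inr 1 : α ⊕ Fin 2) (Pi.single (Sum.inr 0) 1) = Pi.single (Sum.inr 0) 1 :=
    squeeze_of_eq_zero (by simp)
  have hcol : ∀ x ∈ realization (delC K a), collapse a x = Pi.single (Sum.inr 0) 1 := fun x hx =>
    collapse_of_le_half (by rw [apply_apex_eq_zero hx]; norm_num)
  let u : C(W, W) :=
    ⟨fun p => ⟨(p.1.1, collapse a (wedgeFold a b p)), p.2.1, collapse_mem hK ha (wedgeFold_mem hab p.2), by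
        obtain ⟨⟨x, y⟩, hx, hy, h⟩ := p
        dsimp only at hx hy h ⊢
        refine h.imp_right ?_
        rintro rfl
        rw [wedgeFold_single_right, hcol x hx]⟩,
      ((continuous_fst.prodMk ((continuous_collapse a).comp (continuous_wedgeFold a b))).comp
        continuous_subtype_val).subtype_mk _⟩
  let w : C(W, W) :=
    ⟨fun p => ⟨(p.1.1, squeeze (Sum.inr 1) p.1.2), p.2.1, squeeze_mem_realization _ p.2.2.1,
        p.2.2.2.imp_right fun h => by rw [h, hsq]⟩,
      ((continuous_fst.prodMk ((continuous_squeeze _).comp continuous_snd)).comp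
        continuous_subtype_val).subtype_mk _⟩
  have hgf : (g.comp f).Homotopic (ContinuousMap.id _) :=
    ((homotopic_of_segment_subset (ContinuousMap.id _) s
      fun x => segment_squeeze_subset a x.2).trans
      (homotopic_of_segment_subset s (g.comp f)
        fun x => segment_wedgeFold_subset hK ha hab x.2)).symm
  have hfu : (f.comp g).Homotopic u := by
    refine homotopic_of_segment_subset _ _ ?_
    rintro ⟨⟨x, y⟩, hx, hy, h⟩
    change segment ℝ (contractTo a b (wedgeFold a b (x, y)), collapse a (wedgeFold a b (x, y)))
      (x, collapse a (wedgeFold a b (x, y))) ⊆ W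
    rw [← Prod.image_mk_segment_left]
    dsimp only at hx hy h
    have hm := collapse_mem hK ha (wedgeFold_mem hab (p := (x, y)) ⟨hx, hy, h⟩)
    rintro _ ⟨z, hz, rfl⟩
    rcases h with rfl | rfl
    · refine ⟨segment_contractTo_subset hK hb hab hy hz, hm, ?_⟩
      rcases le_total (1 / 2) (wedgeFold a b (Pi.single b 1, y) a) with h | h
      · rw [contractTo_of_half_le h, segment_same] at hz
        exact Or.inl hz
      · exact Or.inr (collapse_of_le_half h)
    · rw [wedgeFold_single_right, contractTo_of_eq_zero (apply_apex_eq_zero hx), segment_same] at hz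
      obtain rfl : z = x := hz
      refine ⟨hx, hm, Or.inr ?_⟩
      dsimp only
      rw [wedgeFold_single_right, hcol z hx]
  have huw : u.Homotopic w := by
    refine homotopic_of_segment_subset _ _ ?_
    rintro ⟨⟨x, y⟩, hx, hy, h⟩
    change segment ℝ (x, collapse a (wedgeFold a b (x, y))) (x, squeeze (Sum.inr 1) y) ⊆ W
    rw [← Prod.image_mk_segment_right]
    dsimp only at hx hy h
    rintro _ ⟨z, hz, rfl⟩
    rcases h with rfl | rfl
    · exact ⟨hx, segment_collapse_subset hK ha hba hab hy hz, Or.inl rfl⟩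
    · rw [wedgeFold_single_right, hcol x hx, hsq, segment_same] at hz
      obtain rfl : z = _ := hz
      exact ⟨hx, hyB, Or.inr rfl⟩
  have hw : w.Homotopic (ContinuousMap.id _) := by
    refine (homotopic_of_segment_subset _ _ ?_).symm
    rintro ⟨⟨x, y⟩, hx, hy, h⟩
    change segment ℝ (x, y) (x, squeeze (Sum.inr 1) y) ⊆ W
    rw [← Prod.image_mk_segment_right]
    dsimp only at hx hy h
    rintro _ ⟨z, hz, rfl⟩
    refine ⟨hx, segment_squeeze_subset _ hy hz, h.imp_right ?_⟩
    rintro rfl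
    rw [hsq, segment_same] at hz
    exact hz
  exact ⟨(ContinuousMap.HomotopyEquiv.mk f g hgf ((hfu.trans huw).trans hw)).trans
    e.toHomotopyEquiv⟩
end

section
/- For any labelling λ = (λ₁,…,λ_n) of the cycle graph C_n (n ≥ 3) with λ ≠ (1,…,1), the complex BD^λ(C_n) is either contractible or homotopy equivalent to a wedge of spheres. -/
open Finset

/-- Degree of a vertex `v` in a finite set `H` of edges. -/
def edgeDeg {V : Type*} [DecidableEq V] (H : Finset (Sym2 V)) (v : V) : ℕ :=
  (H.filter (fun e => v ∈ e)).card

/-- The bounded degree complex `BD^λ(G)`: its faces are the finite sets `H` of edges of `G`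
such that every vertex `v` lies on at most `lam v` edges of `H`. -/
def BD {V : Type*} [DecidableEq V] (G : SimpleGraph V) (lam : V → ℕ) :
    Set (Finset (Sym2 V)) :=
  {H | ↑H ⊆ G.edgeSet ∧ ∀ v, edgeDeg H v ≤ lam v}

/-- A base point of the `d`-dimensional unit sphere. -/
noncomputable def spherePt (d : ℕ) : (Metric.sphere (0 : EuclideanSpace ℝ (Fin (d+1))) 1) :=
  ⟨EuclideanSpace.single 0 1, by simp⟩

/-- Wedge of spheres: one `d i`-dimensional sphere for each `i : ι`, with all base points glued
together (to an extra point, so that the empty wedge is a single point). -/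
def WedgeOfSpheres (ι : Type*) (d : ι → ℕ) : Type _ :=
  Quot (fun x y : Unit ⊕ (Σ i : ι, Metric.sphere (0 : EuclideanSpace ℝ (Fin (d i + 1))) 1) =>
    (x = Sum.inl () ∨ ∃ i, x = Sum.inr ⟨i, spherePt (d i)⟩) ∧
    (y = Sum.inl () ∨ ∃ i, y = Sum.inr ⟨i, spherePt (d i)⟩))

noncomputable instance (ι : Type*) (d : ι → ℕ) : TopologicalSpace (WedgeOfSpheres ι d) := by
  unfold WedgeOfSpheres; infer_instance

/-- A space has the homotopy type of a wedge of spheres: it is empty (a "`(-1)`-sphere"), or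
homotopy equivalent to a finite wedge of spheres (a point in the case of the empty wedge). -/
def IsWedgeOfSpheres (X : Type*) [TopologicalSpace X] : Prop :=
  IsEmpty X ∨
    ∃ (n : ℕ) (d : Fin n → ℕ),
      Nonempty (ContinuousMap.HomotopyEquiv X (WedgeOfSpheres (Fin n) d))

section IndependenceSpace

variable {α : Type*} [Fintype α] [DecidableEq α]

/-- Realization of the independence complex of `G` restricted to the vertex set `S`. -/
def indepSpace (G : SimpleGraph α) (S : Finset α) : Set (α → ℝ) :=
  {x | (∀ a, 0 ≤ x a) ∧ ∑ a, x a = 1 ∧ (∀ a ∉ S, x a = 0) ∧ ∀ a b, G.Adj a b → x a * x b = 0}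

/-- Moving the fraction `t` of the mass at `v` to `u`. -/
def moveMass (u v : α) (t : ℝ) (x : α → ℝ) : α → ℝ :=
  x + (t * x v) • (Pi.single u 1 - Pi.single v 1)

omit [Fintype α] in
lemma continuous_moveMass (u v : α) :
    Continuous fun p : ℝ × (α → ℝ) => moveMass u v p.1 p.2 := by
  unfold moveMass
  fun_prop

omit [Fintype α] in
lemma moveMass_of_eq_zero {u v : α} {t : ℝ} {x : α → ℝ} (h : t * x v = 0) :
    moveMass u v t x = x := by
  simp [moveMass, h]

omit [Fintype α] in
lemma moveMass_apply_left {u v : α} (huv : u ≠ v) (t : ℝ) (x : α → ℝ) :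
    moveMass u v t x u = x u + t * x v := by
  simp [moveMass, huv]

omit [Fintype α] in
lemma moveMass_apply_right {u v : α} (huv : u ≠ v) (t : ℝ) (x : α → ℝ) :
    moveMass u v t x v = (1 - t) * x v := by
  simp [moveMass, huv.symm]
  ring

omit [Fintype α] in
lemma moveMass_apply_of_ne {u v a : α} (hu : a ≠ u) (hv : a ≠ v) (t : ℝ) (x : α → ℝ) :
    moveMass u v t x a = x a := by
  simp [moveMass, hu, hv]

lemma moveMass_mem {G : SimpleGraph α} {S : Finset α} {u v : α} (hu : u ∈ S) (huv : u ≠ v)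
    (hN : ∀ w ∈ S, G.Adj u w → G.Adj v w) {t : ℝ} (ht : t ∈ Set.Icc (0 : ℝ) 1)
    {x : α → ℝ} (hx : x ∈ indepSpace G S) : moveMass u v t x ∈ indepSpace G S := by
  obtain ⟨h0, h1, hS, hG⟩ := hx
  have key : ∀ w, G.Adj u w → moveMass u v t x u * moveMass u v t x w = 0 := by
    intro w hw
    by_cases hwS : w ∈ S
    · have hvw := hN w hwS hw
      rw [moveMass_apply_left huv, moveMass_apply_of_ne hw.ne' hvw.ne', add_mul, hG u w hw,
        mul_assoc, hG v w hvw, mul_zero, add_zero]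
    · by_cases hwv : w = v
      · subst hwv
        rw [moveMass_apply_right huv, hS w hwS, mul_zero, mul_zero]
      · rw [moveMass_apply_of_ne hw.ne' hwv, hS w hwS, mul_zero]
  have key' : ∀ w, G.Adj v w → moveMass u v t x v * moveMass u v t x w = 0 := by
    intro w hw
    by_cases hwu : w = u
    · subst hwu
      rw [mul_comm]
      exact key v hw.symm
    · rw [moveMass_apply_right huv, moveMass_apply_of_ne hwu hw.ne', mul_assoc, hG v w hw,
        mul_zero]
  refine ⟨fun a => ?_, ?_, fun a ha => ?_, fun a b hab => ?_⟩
  · by_cases hau : a = u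
    · subst hau
      rw [moveMass_apply_left huv]
      exact add_nonneg (h0 _) (mul_nonneg ht.1 (h0 _))
    by_cases hav : a = v
    · subst hav
      rw [moveMass_apply_right huv]
      exact mul_nonneg (sub_nonneg.2 ht.2) (h0 _)
    rw [moveMass_apply_of_ne hau hav]
    exact h0 a
  · simp [moveMass, sum_add_distrib, ← mul_sum, h1]
  · have hau : a ≠ u := fun h => ha (h ▸ hu)
    by_cases hav : a = v
    · subst hav
      rw [moveMass_apply_right huv, hS a ha, mul_zero]
    · rw [moveMass_apply_of_ne hau hav, hS a ha]
  · by_cases hau : a = u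
    · exact hau ▸ key b (hau ▸ hab)
    by_cases hav : a = v
    · exact hav ▸ key' b (hav ▸ hab)
    by_cases hbu : b = u
    · subst hbu
      rw [mul_comm]
      exact key a hab.symm
    by_cases hbv : b = v
    · subst hbv
      rw [mul_comm]
      exact key' a hab.symm
    rw [moveMass_apply_of_ne hau hav, moveMass_apply_of_ne hbu hbv, hG a b hab]

omit [DecidableEq α] in
lemma indepSpace_mono (G : SimpleGraph α) {S T : Finset α} (h : S ⊆ T) :
    indepSpace G S ⊆ indepSpace G T :=
  fun _ hx => ⟨hx.1, hx.2.1, fun a ha => hx.2.2.1 a fun h' => ha (h h'), hx.2.2.2⟩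

lemma moveMass_one_mem {G : SimpleGraph α} {S : Finset α} {u v : α} (hu : u ∈ S) (huv : u ≠ v)
    (hN : ∀ w ∈ S, G.Adj u w → G.Adj v w) {x : α → ℝ} (hx : x ∈ indepSpace G S) :
    moveMass u v 1 x ∈ indepSpace G (S.erase v) := by
  obtain ⟨h0, h1, hS, hG⟩ := moveMass_mem hu huv hN (by simp : (1 : ℝ) ∈ Set.Icc (0 : ℝ) 1) hx
  refine ⟨h0, h1, fun a ha => ?_, hG⟩
  by_cases hav : a = v
  · subst hav
    simp [moveMass_apply_right huv]
  · exact hS a fun h => ha (mem_erase.2 ⟨hav, h⟩)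

/-- The fold lemma: a vertex dominating the neighbourhood of another one can be removed. -/
lemma nonempty_homotopyEquiv_indepSpace_erase {G : SimpleGraph α} {S : Finset α} {u v : α}
    (hu : u ∈ S) (huv : u ≠ v) (hN : ∀ w ∈ S, G.Adj u w → G.Adj v w) :
    Nonempty (ContinuousMap.HomotopyEquiv (indepSpace G S) (indepSpace G (S.erase v))) := by
  have hcont := continuous_moveMass u v
  let f : C(indepSpace G S, indepSpace G (S.erase v)) :=
    ⟨fun x => ⟨moveMass u v 1 x, moveMass_one_mem hu huv hN x.2⟩,
      (hcont.comp (continuous_const.prodMk continuous_subtype_val)).subtype_mk _⟩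
  let g : C(indepSpace G (S.erase v), indepSpace G S) :=
    ⟨Set.inclusion (indepSpace_mono G (erase_subset v S)), continuous_inclusion _⟩
  let H : ContinuousMap.Homotopy (ContinuousMap.id (indepSpace G S)) (g.comp f) :=
    { toFun := fun p => ⟨moveMass u v p.1 p.2, moveMass_mem hu huv hN p.1.2 p.2.2⟩
      continuous_toFun := (hcont.comp ((continuous_subtype_val.comp continuous_fst).prodMk
        (continuous_subtype_val.comp continuous_snd))).subtype_mk _
      map_zero_left := fun x => Subtype.ext (moveMass_of_eq_zero (by simp))
      map_one_left := fun x => rfl }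
  have hfg : f.comp g = ContinuousMap.id _ := by
    ext1 x
    exact Subtype.ext (moveMass_of_eq_zero (by
      rw [one_mul]
      exact x.2.2.2.1 v (notMem_erase v S)))
  exact ⟨⟨f, g, ⟨H.symm⟩, hfg ▸ ContinuousMap.Homotopic.refl _⟩⟩

lemma contractibleSpace_indepSpace {G : SimpleGraph α} {S : Finset α} {u : α} (hu : u ∈ S)
    (hN : ∀ w ∈ S, ¬ G.Adj u w) : ContractibleSpace (indepSpace G S) := by
  have hmem : (Pi.single u 1 : α → ℝ) ∈ indepSpace G S := by
    refine ⟨fun a => ?_, by simp, fun a ha => ?_, fun a b hab => ?_⟩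
    · by_cases h : a = u
      · subst h; simp
      · simp [h]
    · have : a ≠ u := fun h => ha (h ▸ hu)
      simp [this]
    · by_cases h : a = u
      · subst h
        simp [hab.ne']
      · simp [h]
  have hstar : StarConvex ℝ (Pi.single u 1 : α → ℝ) (indepSpace G S) := by
    rintro x ⟨h0, h1, hS, hG⟩ s t hs ht hst
    have hx : ∀ w, G.Adj u w → x w = 0 := fun w hw => hS w fun h => hN w h hw
    have hne : ∀ a, a ≠ u → (s • Pi.single u 1 + t • x : α → ℝ) a = t * x a := by
      intro a ha
      simp [ha]
    refine ⟨fun a => ?_, ?_, fun a ha => ?_, fun a b hab => ?_⟩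
    · exact add_nonneg (mul_nonneg hs (hmem.1 a)) (mul_nonneg ht (h0 a))
    · simp [sum_add_distrib, ← mul_sum, h1, hst]
    · rw [hne a fun h => ha (h ▸ hu), hS a ha, mul_zero]
    · by_cases hau : a = u
      · subst hau
        rw [hne b hab.ne', hx b hab, mul_zero, mul_zero]
      by_cases hbu : b = u
      · subst hbu
        rw [hne a hau, hx a hab.symm, mul_zero, zero_mul]
      rw [hne a hau, hne b hbu, mul_mul_mul_comm, hG a b hab, mul_zero]
  exact hstar.contractibleSpace ⟨_, hmem⟩

omit [DecidableEq α] in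
lemma isEmpty_indepSpace_empty (G : SimpleGraph α) : IsEmpty (indepSpace G ∅) :=
  ⟨fun x => by simpa [fun a => x.2.2.2.1 a (notMem_empty a)] using x.2.2.1⟩

end IndependenceSpace

/-- A wedge of a single sphere is that sphere. -/
noncomputable def wedgeOfSpheresUnique (d : ℕ) :
    WedgeOfSpheres (Fin 1) (fun _ => d) ≃ₜ
      Metric.sphere (0 : EuclideanSpace ℝ (Fin (d + 1))) 1 where
  toFun := Quot.lift (Sum.elim (fun _ => spherePt d) Sigma.snd) (by
    have h : ∀ z : Unit ⊕ (Σ _ : Fin 1, Metric.sphere (0 : EuclideanSpace ℝ (Fin (d + 1))) 1),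
        (z = Sum.inl () ∨ ∃ i, z = Sum.inr ⟨i, spherePt d⟩) →
          Sum.elim (fun _ => spherePt d) Sigma.snd z = spherePt d := by
      rintro _ (rfl | ⟨i, rfl⟩) <;> rfl
    rintro x y ⟨hx, hy⟩
    exact (h x hx).trans (h y hy).symm)
  invFun x := Quot.mk _ (Sum.inr ⟨0, x⟩)
  left_inv := by
    rintro ⟨⟨⟩ | ⟨i, x⟩⟩
    · exact Quot.sound ⟨Or.inr ⟨0, rfl⟩, Or.inl rfl⟩
    · obtain rfl := Subsingleton.elim i 0
      rfl
  right_inv x := rfl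
  continuous_toFun := by
    refine continuous_quot_lift _ ?_
    exact continuous_const.sumElim (continuous_sigma fun _ => continuous_id)
  continuous_invFun := continuous_quot_mk.comp (continuous_inr.comp continuous_sigmaMk)

section CrossPolytope

variable {α : Type*} [Fintype α] [DecidableEq α] {d : ℕ} (a b : Fin (d + 1) → α)

/-- The signed coordinates of a point of the boundary of a cross-polytope. -/
noncomputable def signedCoords (x : α → ℝ) : EuclideanSpace ℝ (Fin (d + 1)) :=
  WithLp.toLp 2 fun i => x (a i) - x (b i)

/-- The nonnegative weights on the vertices of a cross-polytope with given signed coordinates. -/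
noncomputable def crossWeights (z : EuclideanSpace ℝ (Fin (d + 1))) : α → ℝ :=
  ∑ i, (Pi.single (a i) (max (z i) 0) + Pi.single (b i) (max (-z i) 0))

omit [Fintype α] [DecidableEq α] in
lemma continuous_signedCoords : Continuous (signedCoords a b) := by
  unfold signedCoords
  fun_prop

omit [Fintype α] in
lemma continuous_crossWeights : Continuous (crossWeights a b) := by
  refine continuous_finsetSum _ fun i _ => .add ?_ ?_
  · exact (continuous_single (A := fun _ : α => ℝ) (a i)).comp (by fun_prop)
  · exact (continuous_single (A := fun _ : α => ℝ) (b i)).comp (by fun_prop)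

omit [Fintype α] [DecidableEq α] in
lemma signedCoords_smul (t : ℝ) (x : α → ℝ) :
    signedCoords a b (t • x) = t • signedCoords a b x := by
  ext i
  simp [signedCoords, mul_sub]

omit [Fintype α] in
lemma crossWeights_smul {t : ℝ} (ht : 0 ≤ t) (z : EuclideanSpace ℝ (Fin (d + 1))) :
    crossWeights a b (t • z) = t • crossWeights a b z := by
  unfold crossWeights
  rw [smul_sum]
  refine sum_congr rfl fun i _ => ?_
  rw [smul_add, ← Pi.single_smul', ← Pi.single_smul', smul_eq_mul, smul_eq_mul,
    mul_max_of_nonneg _ _ ht, mul_max_of_nonneg _ _ ht]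
  simp

lemma sum_crossWeights (z : EuclideanSpace ℝ (Fin (d + 1))) :
    ∑ c, crossWeights a b z c = ∑ i, |z i| := by
  simp only [crossWeights, Finset.sum_apply]
  rw [sum_comm]
  refine sum_congr rfl fun i _ => ?_
  simp [sum_add_distrib, max_zero_add_max_neg_zero_eq_abs_self]

omit [Fintype α] in
lemma crossWeights_nonneg (z : EuclideanSpace ℝ (Fin (d + 1))) (c : α) :
    0 ≤ crossWeights a b z c := by
  have h : 0 ≤ crossWeights a b z :=
    sum_nonneg fun i _ => add_nonneg (Pi.single_nonneg.2 (le_max_right _ _))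
      (Pi.single_nonneg.2 (le_max_right _ _))
  exact h c

variable {a b}

omit [Fintype α] in
lemma crossWeights_of_notMem {c : α} (hc : ∀ i, c ≠ a i ∧ c ≠ b i)
    (z : EuclideanSpace ℝ (Fin (d + 1))) : crossWeights a b z c = 0 := by
  simp only [crossWeights, Finset.sum_apply]
  exact sum_eq_zero fun i _ => by simp [(hc i).1, (hc i).2]

omit [Fintype α] in
lemma crossWeights_apply_left (hinj : Function.Injective (Sum.elim a b))
    (z : EuclideanSpace ℝ (Fin (d + 1))) (i : Fin (d + 1)) :
    crossWeights a b z (a i) = max (z i) 0 := by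
  have ha : ∀ j, a i = a j ↔ i = j := fun j => (hinj.comp Sum.inl_injective).eq_iff
  have hab : ∀ j, a i ≠ b j := fun j h => Sum.inl_ne_inr (@hinj (.inl i) (.inr j) h)
  simp [crossWeights, Finset.sum_apply, Pi.single_apply, ha, hab]

omit [Fintype α] in
lemma crossWeights_apply_right (hinj : Function.Injective (Sum.elim a b))
    (z : EuclideanSpace ℝ (Fin (d + 1))) (i : Fin (d + 1)) :
    crossWeights a b z (b i) = max (-z i) 0 := by
  have hb : ∀ j, b i = b j ↔ i = j := fun j => (hinj.comp Sum.inr_injective).eq_iff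
  have hab : ∀ j, b i ≠ a j := fun j h => Sum.inr_ne_inl (@hinj (.inr i) (.inl j) h)
  simp [crossWeights, Finset.sum_apply, Pi.single_apply, hb, hab]

omit [Fintype α] in
lemma signedCoords_crossWeights (hinj : Function.Injective (Sum.elim a b))
    (z : EuclideanSpace ℝ (Fin (d + 1))) : signedCoords a b (crossWeights a b z) = z := by
  ext i
  simp only [signedCoords, crossWeights_apply_left hinj, crossWeights_apply_right hinj]
  exact max_zero_sub_eq_self _

variable {G : SimpleGraph α} {S : Finset α}

lemma crossWeights_signedCoords (hinj : Function.Injective (Sum.elim a b))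
    (hS : ∀ c, c ∈ S ↔ ∃ i, c = a i ∨ c = b i) (hab : ∀ i, G.Adj (a i) (b i))
    {x : α → ℝ} (hx : x ∈ indepSpace G S) : crossWeights a b (signedCoords a b x) = x := by
  obtain ⟨h0, h1, hS0, hG⟩ := hx
  ext c
  by_cases hc : c ∈ S
  · obtain ⟨i, rfl | rfl⟩ := (hS c).1 hc
    · rw [crossWeights_apply_left hinj]
      rcases mul_eq_zero.1 (hG _ _ (hab i)) with h | h <;> simp [signedCoords, h, h0]
    · rw [crossWeights_apply_right hinj]
      rcases mul_eq_zero.1 (hG _ _ (hab i)) with h | h <;> simp [signedCoords, h, h0]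
  · rw [crossWeights_of_notMem, hS0 c hc]
    exact fun i => ⟨fun h => hc ((hS c).2 ⟨i, .inl h⟩), fun h => hc ((hS c).2 ⟨i, .inr h⟩)⟩

lemma smul_crossWeights_mem (hinj : Function.Injective (Sum.elim a b))
    (hS : ∀ c, c ∈ S ↔ ∃ i, c = a i ∨ c = b i)
    (hadj : ∀ c ∈ S, ∀ c' ∈ S, G.Adj c c' →
      ∃ i, (c = a i ∧ c' = b i) ∨ (c = b i ∧ c' = a i))
    {z : EuclideanSpace ℝ (Fin (d + 1))} (hz : 0 < ∑ i, |z i|) :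
    (∑ i, |z i|)⁻¹ • crossWeights a b z ∈ indepSpace G S := by
  have hS0 : ∀ c ∉ S, crossWeights a b z c = 0 := fun c hc => crossWeights_of_notMem
    (fun i => ⟨fun h => hc ((hS c).2 ⟨i, .inl h⟩), fun h => hc ((hS c).2 ⟨i, .inr h⟩)⟩) z
  have hmul : ∀ i, max (z i) 0 * max (-z i) 0 = 0 := by
    intro i
    rcases le_total (z i) 0 with h | h <;> simp [h]
  refine ⟨fun c => mul_nonneg (inv_nonneg.2 hz.le) (crossWeights_nonneg a b z c), ?_,
    fun c hc => by simp [hS0 c hc], fun c c' hcc => ?_⟩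
  · simp only [Pi.smul_apply, smul_eq_mul, ← mul_sum, sum_crossWeights]
    exact inv_mul_cancel₀ hz.ne'
  · by_cases hc : c ∈ S
    · by_cases hc' : c' ∈ S
      · obtain ⟨i, ⟨rfl, rfl⟩ | ⟨rfl, rfl⟩⟩ := hadj c hc c' hc' hcc
        · simp only [Pi.smul_apply, smul_eq_mul, crossWeights_apply_left hinj,
            crossWeights_apply_right hinj]
          rw [mul_mul_mul_comm, hmul, mul_zero]
        · simp only [Pi.smul_apply, smul_eq_mul, crossWeights_apply_left hinj,
            crossWeights_apply_right hinj]
          rw [mul_mul_mul_comm, mul_comm (max _ _), hmul, mul_zero]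
      · simp [hS0 c' hc']
    · simp [hS0 c hc]

/-- The independence complex of a perfect matching is the boundary of a cross-polytope, hence its
realization is a sphere. -/
noncomputable def indepSpaceHomeomorphSphere (hinj : Function.Injective (Sum.elim a b))
    (hS : ∀ c, c ∈ S ↔ ∃ i, c = a i ∨ c = b i) (hab : ∀ i, G.Adj (a i) (b i))
    (hadj : ∀ c ∈ S, ∀ c' ∈ S, G.Adj c c' →
      ∃ i, (c = a i ∧ c' = b i) ∨ (c = b i ∧ c' = a i)) :
    indepSpace G S ≃ₜ Metric.sphere (0 : EuclideanSpace ℝ (Fin (d + 1))) 1 :=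
  have hy (x : indepSpace G S) : signedCoords a b x ≠ 0 := fun h => by
    have h1 := crossWeights_signedCoords hinj hS hab x.2
    have h2 := x.2.2.1
    rw [← h1, sum_crossWeights, h] at h2
    simp at h2
  have hsum (x : indepSpace G S) : ∑ i, |signedCoords a b x i| = 1 := by
    rw [← sum_crossWeights a b, crossWeights_signedCoords hinj hS hab x.2]
    exact x.2.2.1
  have hz (z : Metric.sphere (0 : EuclideanSpace ℝ (Fin (d + 1))) 1) :
      0 < ∑ i, |(z : EuclideanSpace ℝ (Fin (d + 1))) i| := by
    refine lt_of_le_of_ne (sum_nonneg fun i _ => abs_nonneg _) fun h => ?_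
    have h0 := (sum_eq_zero_iff_of_nonneg fun i _ => abs_nonneg _).1 h.symm
    have hz0 : (z : EuclideanSpace ℝ (Fin (d + 1))) = 0 := by
      ext i
      simpa using h0 i (mem_univ i)
    have h1 := mem_sphere_zero_iff_norm.1 z.2
    rw [hz0] at h1
    simp at h1
  { toFun := fun x => ⟨‖signedCoords a b x‖⁻¹ • signedCoords a b x, by
      rw [mem_sphere_zero_iff_norm, norm_smul, norm_inv, norm_norm]
      exact inv_mul_cancel₀ (norm_ne_zero_iff.2 (hy x))⟩
    invFun := fun z => ⟨(∑ i, |(z : EuclideanSpace ℝ (Fin (d + 1))) i|)⁻¹ • crossWeights a b z,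
      smul_crossWeights_mem hinj hS hadj (hz z)⟩
    left_inv := fun x => by
      have hpos : 0 < ‖signedCoords a b (x : α → ℝ)‖⁻¹ := inv_pos.2 (norm_pos_iff.2 (hy x))
      refine Subtype.ext ?_
      simp only [PiLp.smul_apply, smul_eq_mul, abs_mul, ← mul_sum, hsum x, mul_one,
        abs_of_pos hpos]
      rw [crossWeights_smul a b hpos.le, crossWeights_signedCoords hinj hS hab x.2, smul_smul,
        inv_mul_cancel₀ hpos.ne', one_smul]
    right_inv := fun z => by
      refine Subtype.ext ?_
      have h1 := mem_sphere_zero_iff_norm.1 z.2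
      simp only [signedCoords_smul, signedCoords_crossWeights hinj, norm_smul, h1, mul_one,
        norm_inv, Real.norm_eq_abs, abs_of_pos (hz z)]
      rw [inv_inv, smul_smul, mul_inv_cancel₀ (hz z).ne', one_smul]
    continuous_toFun := by
      have hc : Continuous fun x : indepSpace G S => signedCoords a b x :=
        (continuous_signedCoords a b).comp continuous_subtype_val
      exact ((hc.norm.inv₀ fun x => norm_ne_zero_iff.2 (hy x)).smul hc).subtype_mk _
    continuous_invFun := by
      refine (Continuous.smul (Continuous.inv₀ (by fun_prop) fun z => (hz z).ne') ?_).subtype_mk _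
      exact (continuous_crossWeights a b).comp continuous_subtype_val }

end CrossPolytope

section LinearForest

variable {α : Type*} [Fintype α]

/-- Being contractible or a wedge of spheres. -/
def IsContractibleOrWedge (X : Type*) [TopologicalSpace X] : Prop :=
  ContractibleSpace X ∨ IsWedgeOfSpheres X

lemma IsContractibleOrWedge.of_homotopyEquiv {X Y : Type*} [TopologicalSpace X]
    [TopologicalSpace Y] (e : ContinuousMap.HomotopyEquiv X Y) (h : IsContractibleOrWedge Y) :
    IsContractibleOrWedge X := by
  obtain h | h | ⟨n, d, ⟨f⟩⟩ := h
  · exact .inl e.contractibleSpace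
  · exact .inr (.inl (Function.isEmpty e.toFun))
  · exact .inr (.inr ⟨n, d, ⟨e.trans f⟩⟩)

/-- A graph in which every vertex has exactly one neighbour is a perfect matching. -/
lemma isContractibleOrWedge_indepSpace_of_matching {G : SimpleGraph α} {S : Finset α}
    (hne : S.Nonempty) {pos : α → ℕ} (hpos : Set.InjOn pos S)
    (hex : ∀ u ∈ S, ∃ w ∈ S, G.Adj u w)
    (huniq : ∀ u ∈ S, ∀ v ∈ S, ∀ w ∈ S, G.Adj u v → G.Adj u w → v = w) :
    IsContractibleOrWedge (indepSpace G S) := by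
  classical
  choose! m hmS hm using hex
  have hmm : ∀ u ∈ S, m (m u) = u := fun u hu =>
    huniq (m u) (hmS u hu) _ (hmS _ (hmS u hu)) u hu (hm _ (hmS u hu)) (hm u hu).symm
  have hmne : ∀ u ∈ S, pos (m u) ≠ pos u := fun u hu h =>
    (hm u hu).ne' (hpos (hmS u hu) hu h)
  set T := S.filter fun u => pos u < pos (m u) with hT
  have hTS : ∀ u ∈ S, u ∈ T ∨ m u ∈ T := by
    intro u hu
    rcases lt_or_gt_of_ne (hmne u hu) with h | h
    · exact .inr (mem_filter.2 ⟨hmS u hu, by rwa [hmm u hu]⟩)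
    · exact .inl (mem_filter.2 ⟨hu, h⟩)
  obtain ⟨d, hd⟩ : ∃ d, #T = d + 1 := by
    refine Nat.exists_eq_succ_of_ne_zero (card_ne_zero.2 ?_)
    obtain ⟨u, hu⟩ := hne
    exact (hTS u hu).elim (fun h => ⟨_, h⟩) fun h => ⟨_, h⟩
  let e := T.equivFinOfCardEq hd
  let a : Fin (d + 1) → α := fun i => e.symm i
  have haT : ∀ i, a i ∈ T := fun i => (e.symm i).2
  have haS : ∀ i, a i ∈ S := fun i => (mem_filter.1 (haT i)).1
  have hsurj : ∀ u ∈ T, ∃ i, u = a i := fun u hu => ⟨e ⟨u, hu⟩, by simp [a]⟩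
  have ha : Function.Injective a := Subtype.val_injective.comp e.symm.injective
  have hb : Function.Injective fun i => m (a i) := fun i j h => ha (by
    rw [← hmm _ (haS i), ← hmm _ (haS j)]
    exact congrArg m h)
  have hab : ∀ i j, a i ≠ m (a j) := by
    intro i j h
    have h1 := (mem_filter.1 (haT i)).2
    have h2 := (mem_filter.1 (haT j)).2
    rw [h, hmm _ (haS j)] at h1
    omega
  have hS : ∀ c, c ∈ S ↔ ∃ i, c = a i ∨ c = m (a i) := by
    refine fun c => ⟨fun hc => ?_, ?_⟩
    · rcases hTS c hc with h | h
      · exact (hsurj c h).imp fun i => .inl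
      · obtain ⟨i, hi⟩ := hsurj _ h
        exact ⟨i, .inr (by rw [← hi, hmm c hc])⟩
    · rintro ⟨i, rfl | rfl⟩
      exacts [haS i, hmS _ (haS i)]
  have hadj : ∀ c ∈ S, ∀ c' ∈ S, G.Adj c c' →
      ∃ i, (c = a i ∧ c' = m (a i)) ∨ (c = m (a i) ∧ c' = a i) := by
    intro c hc c' hc' h
    have hc'm : c' = m c := huniq c hc c' hc' _ (hmS c hc) h (hm c hc)
    obtain ⟨i, rfl | rfl⟩ := (hS c).1 hc
    · exact ⟨i, .inl ⟨rfl, hc'm⟩⟩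
    · exact ⟨i, .inr ⟨rfl, hc'm.trans (hmm _ (haS i))⟩⟩
  exact .inr (.inr ⟨1, fun _ => d, ⟨((indepSpaceHomeomorphSphere (ha.sumElim hb hab) hS
    (fun i => hm _ (haS i)) hadj).trans (wedgeOfSpheresUnique d).symm).toHomotopyEquiv⟩⟩)

/-- The independence complex of a linear forest is contractible or a sphere. -/
theorem isContractibleOrWedge_indepSpace (G : SimpleGraph α) (pos : α → ℕ) (S : Finset α)
    (hpos : Set.InjOn pos S)
    (hadj : ∀ u ∈ S, ∀ v ∈ S, G.Adj u v → pos v = pos u + 1 ∨ pos u = pos v + 1) :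
    IsContractibleOrWedge (indepSpace G S) := by
  classical
  induction S using Finset.strongInduction with
  | H S ih =>
    by_cases hiso : ∃ u ∈ S, ∀ w ∈ S, ¬ G.Adj u w
    · obtain ⟨u, hu, hN⟩ := hiso
      exact .inl (contractibleSpace_indepSpace hu hN)
    by_cases hfold : ∃ u ∈ S, ∃ v ∈ S, u ≠ v ∧ ∀ w ∈ S, G.Adj u w → G.Adj v w
    · obtain ⟨u, hu, v, hv, huv, hN⟩ := hfold
      obtain ⟨e⟩ := nonempty_homotopyEquiv_indepSpace_erase hu huv hN
      have hsub : S.erase v ⊆ S := erase_subset v S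
      exact .of_homotopyEquiv e (ih _ (erase_ssubset hv) (hpos.mono (coe_subset.2 hsub))
        fun x hx y hy => hadj x (hsub hx) y (hsub hy))
    push Not at hiso hfold
    rcases S.eq_empty_or_nonempty with rfl | hne
    · exact .inr (.inl (isEmpty_indepSpace_empty G))
    have huniq : ∀ n, ∀ u ∈ S, pos u = n →
        ∀ v ∈ S, ∀ w ∈ S, G.Adj u v → G.Adj u w → v = w := by
      intro n
      induction n using Nat.strong_induction_on with
      | _ n ihn =>
        intro u hu hun
        have key : ∀ v ∈ S, ∀ w ∈ S, G.Adj u v → G.Adj u w → pos u = pos v + 1 → v = w := by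
          intro v hv w hw huv huw hlt
          by_contra hvw
          obtain ⟨x, hx, hvx, hwx⟩ := hfold v hv w hw hvw
          obtain rfl := ihn (pos v) (by omega) v hv rfl x hx u hu hvx huv.symm
          exact hwx huw.symm
        intro v hv w hw huv huw
        rcases hadj u hu v hv huv with h1 | h1
        · rcases hadj u hu w hw huw with h2 | h2
          · exact hpos hv hw (by omega)
          · exact (key w hw v hv huw huv h2).symm
        · exact key v hv w hw huv huw h1
    exact isContractibleOrWedge_indepSpace_of_matching hne hpos hiso
      fun u hu => huniq _ u hu rfl

end LinearForest

section BoundedDegree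

variable {V : Type*} [DecidableEq V]

/-- Two edges conflict if they share a vertex at which only one edge is allowed. -/
def conflictGraph (lam : V → ℕ) : SimpleGraph (Sym2 V) where
  Adj e f := e ≠ f ∧ ∃ v, v ∈ e ∧ v ∈ f ∧ lam v = 1
  symm := ⟨fun _ _ ⟨h, v, he, hf, hv⟩ => ⟨h.symm, v, hf, he, hv⟩⟩
  loopless := ⟨fun _ h => h.1 rfl⟩

open Classical in
/-- The edges of `G` which are vertices of `BD^λ(G)`. -/
noncomputable def allowedEdges [Fintype V] (G : SimpleGraph V) (lam : V → ℕ) :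
    Finset (Sym2 V) :=
  {e | e ∈ G.edgeSet ∧ ∀ v ∈ e, lam v ≠ 0}

lemma mem_allowedEdges [Fintype V] {G : SimpleGraph V} {lam : V → ℕ} {e : Sym2 V} :
    e ∈ allowedEdges G lam ↔ e ∈ G.edgeSet ∧ ∀ v ∈ e, lam v ≠ 0 := by
  simp [allowedEdges]

/-- If all degrees of `G` are at most two, then `BD^λ(G)` is an independence complex. -/
lemma realization_BD_eq_indepSpace [Fintype V] (G : SimpleGraph V) (lam : V → ℕ)
    (hdeg : ∀ H : Finset (Sym2 V), ↑H ⊆ G.edgeSet → ∀ v, edgeDeg H v ≤ 2) :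
    realization (BD G lam) = indepSpace (conflictGraph lam) (allowedEdges G lam) := by
  classical
  ext x
  constructor
  · rintro ⟨h0, h1, σ, ⟨hσ, hdeg⟩, hx⟩
    refine ⟨h0, h1, fun e he => ?_, fun e f ⟨hef, v, hve, hvf, hv⟩ => ?_⟩
    · by_contra hxe
      refine he (mem_allowedEdges.2 ⟨hσ (hx e hxe), fun v hv hlam => ?_⟩)
      have h := hdeg v
      rw [hlam, Nat.le_zero, edgeDeg, card_eq_zero] at h
      exact notMem_empty e (h ▸ mem_filter.2 ⟨hx e hxe, hv⟩)
    · by_contra hxef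
      have h := hdeg v
      rw [hv, edgeDeg, card_le_one] at h
      exact hef (h e (mem_filter.2 ⟨hx e (left_ne_zero_of_mul hxef), hve⟩)
        f (mem_filter.2 ⟨hx f (right_ne_zero_of_mul hxef), hvf⟩))
  · rintro ⟨h0, h1, hS, hG⟩
    have hσ : ∀ e, x e ≠ 0 → e ∈ G.edgeSet ∧ ∀ v ∈ e, lam v ≠ 0 := fun e he => by
      by_contra h
      exact he (hS e (mt mem_allowedEdges.1 h))
    have hsub : ↑(univ.filter fun e => x e ≠ 0) ⊆ G.edgeSet := fun e he =>
      (hσ e (by simpa using he)).1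
    refine ⟨h0, h1, univ.filter fun e => x e ≠ 0, ⟨hsub, fun v => ?_⟩, by simp⟩
    rcases Nat.lt_or_ge 1 (lam v) with hv | hv
    · exact (hdeg _ hsub v).trans hv
    interval_cases hv' : lam v
    · rw [Nat.le_zero, edgeDeg, card_eq_zero, filter_eq_empty_iff]
      exact fun e he hve => (hσ e (mem_filter.1 he).2).2 v hve hv'
    · rw [edgeDeg, card_le_one]
      intro e he f hf
      by_contra hef
      simp only [mem_filter, mem_univ, true_and] at he hf
      exact mul_ne_zero he.1 hf.1 (hG e f ⟨hef, v, he.2, hf.2, hv'⟩)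

end BoundedDegree

section Cycle

lemma exists_eq_of_mem_edgeSet_cycleGraph {m : ℕ} {e : Sym2 (Fin (m + 2))}
    (he : e ∈ (SimpleGraph.cycleGraph (m + 2)).edgeSet) : ∃ c, e = s(c, c + 1) := by
  induction e with
  | h u v =>
    rcases SimpleGraph.cycleGraph_adj.1 he with h | h
    · exact ⟨v, by rw [← h, add_sub_cancel, Sym2.eq_swap]⟩
    · exact ⟨u, by rw [← h, add_sub_cancel]⟩

lemma edgeDeg_cycleGraph_le_two {m : ℕ} (H : Finset (Sym2 (Fin (m + 2))))
    (hH : ↑H ⊆ (SimpleGraph.cycleGraph (m + 2)).edgeSet) (v : Fin (m + 2)) :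
    edgeDeg H v ≤ 2 := by
  refine (card_le_card (t := {s(v, v + 1), s(v - 1, v)}) fun e he => ?_).trans card_le_two
  obtain ⟨heH, hve⟩ := mem_filter.1 he
  obtain ⟨c, rfl⟩ := exists_eq_of_mem_edgeSet_cycleGraph (hH heH)
  rcases Sym2.mem_iff.1 hve with rfl | rfl <;> simp

lemma val_eq_add_one_of_sub_ne_zero {m : ℕ} {x y z : Fin (m + 2)} (h : x = y + 1) (hx : x ≠ z) :
    (x - z).val = (y - z).val + 1 := by
  have hxy : x - z = (y - z) + 1 := by rw [h, add_sub_right_comm]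
  rw [hxy, Fin.val_add_one, if_neg]
  intro hlast
  rw [hlast, Fin.last_add_one] at hxy
  exact hx (sub_eq_zero.1 hxy)

end Cycle

open SimpleGraph in
/-- for any labelling `λ ≠ (1,…,1)` of the cycle graph `C_n`, `n ≥ 3`, the complex
`BD^λ(C_n)` is either contractible or homotopy equivalent to a wedge of spheres. -/
theorem BD_cycle_contractible_or_wedge (n : ℕ) (hn : 3 ≤ n) (lam : Fin n → ℕ)
    (hlam : lam ≠ fun _ => 1) :
    ContractibleSpace (realization (BD (cycleGraph n) lam)) ∨
      IsWedgeOfSpheres (realization (BD (cycleGraph n) lam)) := by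
  obtain ⟨m, rfl⟩ : ∃ m, n = m + 2 := ⟨n - 2, by omega⟩
  obtain ⟨z, hz⟩ : ∃ z, lam z ≠ 1 := Function.ne_iff.1 hlam
  rw [realization_BD_eq_indepSpace _ lam edgeDeg_cycleGraph_le_two]
  have hex : ∀ e ∈ (cycleGraph (m + 2)).edgeSet, ∃ c, e = s(c, c + 1) :=
    fun e => exists_eq_of_mem_edgeSet_cycleGraph
  choose! c hc using hex
  refine isContractibleOrWedge_indepSpace _ (fun e => (c e - z).val) _ ?_ ?_
  · intro e he f hf hef
    rw [hc e (mem_allowedEdges.1 he).1, hc f (mem_allowedEdges.1 hf).1,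
      sub_left_injective (Fin.val_injective hef)]
  · rintro e he f hf ⟨hef, v, hve, hvf, hv⟩
    have hvz : v ≠ z := fun h => hz (h ▸ hv)
    have hce := hc e (mem_allowedEdges.1 he).1
    have hcf := hc f (mem_allowedEdges.1 hf).1
    have hcef : c e ≠ c f := fun h => hef (by rw [hce, hcf, h])
    rw [hce, Sym2.mem_iff] at hve
    rw [hcf, Sym2.mem_iff] at hvf
    rcases hve with h1 | h1 <;> rcases hvf with h2 | h2
    · exact absurd (h1.symm.trans h2) hcef
    · exact .inr (val_eq_add_one_of_sub_ne_zero (h1.symm.trans h2) (h1 ▸ hvz))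
    · exact .inl (val_eq_add_one_of_sub_ne_zero (h2.symm.trans h1) (h2 ▸ hvz))
    · exact absurd (add_left_injective 1 (h1.symm.trans h2)) hcef
end
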